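/- Conservativity propagates from odd to even rows (part of Theorem 5.1): for every n ≥ 1 and q = (q_1,…,q_n) ∈ (0,1)^n, if Σ_{x′ ∈ W_0^n} Q_{2n−1}(x,x′) = 0 for every x ∈ W_0^n, then Σ_{y′ ∈ W_0^n} Q_{2n}(y,y′) = 0 for every y ∈ W_0^n. (Each row of Q_n has at most 2n+1 nonzero entries, so these sums are finite.) -/

import Mathlib

open scoped BigOperators

noncomputable section

/-- Sum of the entries of an integer vector. -/
def vsum {n : ℕ} (z : Fin n → ℤ) : ℤ := ∑ i, z i

/-- `Interlace x y` means `x ⪯ y`, i.e. `y_i ≤ x_i ≤ y_{i+1}` for `1 ≤ i ≤ n`. -/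
def Interlace {n : ℕ} (x : Fin n → ℤ) (y : Fin (n + 1) → ℤ) : Prop :=
  ∀ i : Fin n, y i.castSucc ≤ x i ∧ x i ≤ y i.succ

/-- `PrecEq x x'` means `x ≺ x'`: `x_1 ≤ x'_1 ≤ x_2 ≤ x'_2 ≤ … ≤ x_k ≤ x'_k`. -/
def PrecEq {k : ℕ} (x x' : Fin k → ℤ) : Prop :=
  (∀ i, x i ≤ x' i) ∧ ∀ (i : ℕ) (h : i + 1 < k), x' ⟨i, Nat.lt_of_succ_lt h⟩ ≤ x ⟨i + 1, h⟩

/-- Membership in `W₀^k = {0 ≤ z_1 ≤ z_2 ≤ ⋯ ≤ z_k}`. -/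
def W0 {k : ℕ} (z : Fin k → ℤ) : Prop := Monotone z ∧ ∀ i, 0 ≤ z i

/-- `p` encodes an integer symplectic Gelfand–Tsetlin pattern with rows `1, …, n`,
row `r` having `⌈r/2⌉ = (r+1)/2` nonnegative entries `p r 0, …`; consecutive rows
satisfy `x^{2i-1} ≺ x^{2i}` and `x^{2i} ⪯ x^{2i+1}`; irrelevant entries are pinned to `0`. -/
def IsSymp (n : ℕ) (p : ℕ → ℕ → ℤ) : Prop :=
  (∀ r i, 1 ≤ r → r ≤ n → i < (r + 1) / 2 → 0 ≤ p r i) ∧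
  (∀ k, 1 ≤ k → 2 * k ≤ n →
    (∀ j, j < k → p (2 * k - 1) j ≤ p (2 * k) j) ∧
    (∀ j, j + 1 < k → p (2 * k) j ≤ p (2 * k - 1) (j + 1))) ∧
  (∀ k, 1 ≤ k → 2 * k + 1 ≤ n →
    (∀ j, j < k → p (2 * k + 1) j ≤ p (2 * k) j ∧ p (2 * k) j ≤ p (2 * k + 1) (j + 1))) ∧
  (∀ r i, r = 0 ∨ n < r ∨ (r + 1) / 2 ≤ i → p r i = 0)

/-- `|x^r|`, the sum of the entries of row `r` (row `r` has `(r+1)/2` entries). -/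
def rowSumS (p : ℕ → ℕ → ℤ) (r : ℕ) : ℤ := ∑ i ∈ Finset.range ((r + 1) / 2), p r i

/-- The geometric weight `w^q_n(x)`: each row `r` contributes
`q_{⌈r/2⌉}^{|x^r|−|x^{r−1}|}` if `r` is odd and `q_{r/2}^{−(|x^r|−|x^{r−1}|)}` if `r`
is even, which reproduces `w^q_{2k−1}` and `w^q_{2k}` (0-based rates). -/
def wSymp (n : ℕ) (q : ℕ → ℝ) (p : ℕ → ℕ → ℤ) : ℝ :=
  ∏ r ∈ Finset.Icc 1 n,
    q ((r + 1) / 2 - 1) ^ ((if r % 2 = 1 then (1 : ℤ) else -1) * (rowSumS p r - rowSumS p (r - 1)))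

/-- The symplectic Schur function `Sp^{2k−1}_z(q_1,…,q_k)`. -/
def SpOdd (k : ℕ) (q : ℕ → ℝ) (z : Fin k → ℤ) : ℝ :=
  ∑ᶠ p ∈ {p : ℕ → ℕ → ℤ | IsSymp (2 * k - 1) p ∧ ∀ i : Fin k, p (2 * k - 1) i = z i},
    wSymp (2 * k - 1) q p

/-- The symplectic Schur function `Sp^{2k}_z(q_1,…,q_k)`. -/
def SpEven (k : ℕ) (q : ℕ → ℝ) (z : Fin k → ℤ) : ℝ :=
  ∑ᶠ p ∈ {p : ℕ → ℕ → ℤ | IsSymp (2 * k) p ∧ ∀ i : Fin k, p (2 * k) i = z i},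
    wSymp (2 * k) q p

open Classical in
/-- The `Q`-matrix `Q_{2k−1}` on `W₀^k` (here `k = m+1`): jumps `x → x ± e_i` at rate
`Sp^{2k−1}_{x±e_i}(q)/Sp^{2k−1}_x(q)` whenever `x ± e_i ∈ W₀^k`, with diagonal
`−[Σ_{i=1}^{k−1}(q_i+q_i^{−1}) + q_k^{−1}·1{x_1>0} + q_k]`. -/
def Qodd (m : ℕ) (q : ℕ → ℝ) (x x' : Fin (m + 1) → ℤ) : ℝ :=
  if x' = x then
    -((∑ i ∈ Finset.range m, (q i + (q i)⁻¹)) +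
      (q m)⁻¹ * (if 0 < x 0 then 1 else 0) + q m)
  else if (∃ i, x' = x + Pi.single i 1 ∨ x' = x - Pi.single i 1) ∧ W0 x' then
    SpOdd (m + 1) q x' / SpOdd (m + 1) q x
  else 0

open Classical in
/-- The `Q`-matrix `Q_{2k}` on `W₀^k` (here `k = m+1`): jumps `x → x ± e_i` at rate
`Sp^{2k}_{x±e_i}(q)/Sp^{2k}_x(q)` whenever `x ± e_i ∈ W₀^k`, with diagonal
`−Σ_{i=1}^{k}(q_i+q_i^{−1})`. -/
def Qeven (m : ℕ) (q : ℕ → ℝ) (x x' : Fin (m + 1) → ℤ) : ℝ :=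
  if x' = x then -(∑ i ∈ Finset.range (m + 1), (q i + (q i)⁻¹))
  else if (∃ i, x' = x + Pi.single i 1 ∨ x' = x - Pi.single i 1) ∧ W0 x' then
    SpEven (m + 1) q x' / SpEven (m + 1) q x
  else 0

/-- Lower end of the range of the `j`-th entry of a row `x ≺ y` with nonnegative entries:
`0` for the first entry and the previous entry of `y` otherwise. -/
def precLower {n : ℕ} (y : Fin n → ℤ) (j : Fin n) : ℤ :=
  if (j : ℕ) = 0 then 0 else y ⟨j - 1, by omega⟩

/-- The finite set of nonnegative vectors `x` with `x ≺ y`. -/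
def precBox {n : ℕ} (y : Fin n → ℤ) : Finset (Fin n → ℤ) := Finset.Icc (precLower y) y

lemma mem_precBox {n : ℕ} {x y : Fin n → ℤ} :
    x ∈ precBox y ↔ ∀ j, precLower y j ≤ x j ∧ x j ≤ y j := by
  simp [precBox, Pi.le_def, forall_and]

lemma precLower_succ {n : ℕ} (y : Fin n → ℤ) (i : ℕ) (h : i + 1 < n) :
    precLower y ⟨i + 1, h⟩ = y ⟨i, Nat.lt_of_succ_lt h⟩ := by
  simp [precLower]

lemma precLower_of_val_eq_zero {n : ℕ} (y : Fin n → ℤ) {j : Fin n} (h : (j : ℕ) = 0) :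
    precLower y j = 0 := by
  simp [precLower, h]

lemma precLower_add_single {n : ℕ} (y : Fin n → ℤ) (i : Fin n) (c : ℤ) (j : Fin n) :
    precLower (y + Pi.single i c) j = precLower y j + if (j : ℕ) = i + 1 then c else 0 := by
  unfold precLower
  by_cases h : (j : ℕ) = 0
  · simp [h]
  · by_cases h' : (j : ℕ) = i + 1
    · have : (⟨j - 1, by omega⟩ : Fin n) = i := by ext; simp; omega
      simp [h']
    · have : (⟨j - 1, by omega⟩ : Fin n) ≠ i := by
        intro e; have := congrArg Fin.val e; simp at this; omega
      simp [h, h', this]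

lemma W0.of_mem_precBox {n : ℕ} {x y : Fin n → ℤ} (hx : x ∈ precBox y) : W0 x := by
  rw [mem_precBox] at hx
  have hm : Monotone x := by
    cases n with
    | zero => intro i; exact i.elim0
    | succ n =>
      refine Fin.monotone_iff_le_succ.2 fun i => ?_
      refine (hx i.castSucc).2.trans ?_
      have := (hx i.succ).1
      rwa [Fin.succ, precLower_succ] at this
  refine ⟨hm, fun i => ?_⟩
  have h0 : 0 < n := i.pos
  refine le_trans ?_ (hm (show (⟨0, h0⟩ : Fin n) ≤ i from Nat.zero_le _))
  have := (hx ⟨0, h0⟩).1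
  rwa [precLower_of_val_eq_zero _ rfl] at this

lemma W0.precLower_le {n : ℕ} {y : Fin n → ℤ} (hy : W0 y) (j : Fin n) : precLower y j ≤ y j := by
  unfold precLower
  split_ifs
  · exact hy.2 j
  · exact hy.1 (show (j : ℕ) - 1 ≤ j by omega)

lemma W0.self_mem_precBox {n : ℕ} {y : Fin n → ℤ} (hy : W0 y) : y ∈ precBox y :=
  mem_precBox.2 fun j => ⟨hy.precLower_le j, le_rfl⟩

lemma precBox_eq_empty {n : ℕ} {y : Fin n → ℤ} (hy : ¬ W0 y) : precBox y = ∅ := by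
  refine Finset.eq_empty_of_forall_notMem fun x hx => hy ?_
  have hx0 := W0.of_mem_precBox hx
  rw [mem_precBox] at hx
  refine ⟨?_, fun i => (hx0.2 i).trans (hx i).2⟩
  cases n with
  | zero => intro i; exact i.elim0
  | succ n =>
    refine Fin.monotone_iff_le_succ.2 fun i => ?_
    refine le_trans ?_ (hx i.succ).2
    have := (hx i.succ).1
    rwa [Fin.succ, precLower_succ] at this

/-- The face of `precBox y` on which the `j`-th entry is minimal; empty if `j` is out of range. -/
def lowerFace {n : ℕ} (y : Fin n → ℤ) (j : ℕ) : Finset (Fin n → ℤ) :=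
  (precBox y).filter fun x => ∃ h : j < n, x ⟨j, h⟩ = precLower y ⟨j, h⟩

/-- The `j`-th lower face of `precBox y` pushed one step outside of the box. -/
def outerFace {n : ℕ} (y : Fin n → ℤ) (j : ℕ) : Finset (Fin n → ℤ) :=
  (Finset.Icc (precLower y - 1) y).filter fun x =>
    ∃ h : j < n, x ⟨j, h⟩ = precLower y ⟨j, h⟩ - 1 ∧
      ∀ l : Fin n, (l : ℕ) ≠ j → precLower y l ≤ x l

lemma mem_lowerFace {n : ℕ} {x y : Fin n → ℤ} {j : ℕ} :
    x ∈ lowerFace y j ↔ (∀ l, precLower y l ≤ x l ∧ x l ≤ y l) ∧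
      ∃ h : j < n, x ⟨j, h⟩ = precLower y ⟨j, h⟩ := by
  simp [lowerFace, mem_precBox]

lemma mem_outerFace {n : ℕ} {x y : Fin n → ℤ} (hy : W0 y) {j : ℕ} :
    x ∈ outerFace y j ↔ ∃ h : j < n, x ⟨j, h⟩ = precLower y ⟨j, h⟩ - 1 ∧
      ∀ l : Fin n, (l : ℕ) ≠ j → precLower y l ≤ x l ∧ x l ≤ y l := by
  simp only [outerFace, Finset.mem_filter, Finset.mem_Icc, Pi.le_def, Pi.sub_apply, Pi.one_apply]
  constructor
  · rintro ⟨⟨h1, h2⟩, h, h3, h4⟩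
    exact ⟨h, h3, fun l hl => ⟨h4 l hl, h2 l⟩⟩
  · rintro ⟨h, h3, h4⟩
    refine ⟨⟨fun l => ?_, fun l => ?_⟩, h, h3, fun l hl => (h4 l hl).1⟩
    · by_cases hl : (l : ℕ) = j
      · obtain rfl : l = ⟨j, h⟩ := Fin.ext hl
        omega
      · have := (h4 l hl).1; omega
    · by_cases hl : (l : ℕ) = j
      · obtain rfl : l = ⟨j, h⟩ := Fin.ext hl
        have := hy.precLower_le ⟨j, h⟩
        omega
      · exact (h4 l hl).2

lemma sum_add_sum_eq_of_indicator {α : Type*} [DecidableEq α] (F : α → ℝ) (A B C D : Finset α)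
    (h : ∀ x, F x ≠ 0 → ((if x ∈ A then 1 else 0) + (if x ∈ B then 1 else 0) : ℕ) =
      (if x ∈ C then 1 else 0) + (if x ∈ D then 1 else 0)) :
    ∑ x ∈ A, F x + ∑ x ∈ B, F x = ∑ x ∈ C, F x + ∑ x ∈ D, F x := by
  have key : ∀ E ⊆ A ∪ B ∪ C ∪ D, ∑ x ∈ E, F x =
      ∑ x ∈ A ∪ B ∪ C ∪ D, ((if x ∈ E then 1 else 0 : ℕ) : ℝ) * F x := by
    intro E hE
    simp only [Nat.cast_ite, Nat.cast_one, Nat.cast_zero, ite_mul, one_mul, zero_mul]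
    rw [Finset.sum_ite_mem, Finset.inter_eq_right.2 hE]
  rw [key A (by intro; simp; tauto), key B (by intro; simp; tauto), key C (by intro; simp; tauto),
    key D (by intro; simp; tauto), ← Finset.sum_add_distrib, ← Finset.sum_add_distrib]
  refine Finset.sum_congr rfl fun x _ => ?_
  by_cases hx : F x = 0
  · simp [hx]
  · rw [← add_mul, ← add_mul]
    exact_mod_cast congrArg (fun t : ℕ => (t : ℝ) * F x) (h x hx)

/-- `P` holds at all indices other than `i` and `i + 1`. -/
def AwayFrom {n : ℕ} (i : ℕ) (P : Fin n → Prop) : Prop :=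
  ∀ j : Fin n, (j : ℕ) ≠ i → (j : ℕ) ≠ i + 1 → P j

lemma AwayFrom.congr {n : ℕ} {i : ℕ} {P Q : Fin n → Prop}
    (h : ∀ j : Fin n, (j : ℕ) ≠ i → (j : ℕ) ≠ i + 1 → (P j ↔ Q j)) :
    AwayFrom i P ↔ AwayFrom i Q :=
  forall_congr' fun j => forall_congr' fun ha => forall_congr' fun hb => h j ha hb

lemma forall_fin_iff_of_succ_lt {n : ℕ} (P : Fin n → Prop) (i : ℕ) (h : i + 1 < n) :
    (∀ j, P j) ↔ AwayFrom i P ∧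
      P ⟨i, Nat.lt_of_succ_lt h⟩ ∧ P ⟨i + 1, h⟩ := by
  refine ⟨fun H => ⟨fun j _ _ => H j, H _, H _⟩, fun ⟨H, H1, H2⟩ j => ?_⟩
  by_cases h1 : (j : ℕ) = i
  · obtain rfl : j = ⟨i, Nat.lt_of_succ_lt h⟩ := Fin.ext h1
    exact H1
  · by_cases h2 : (j : ℕ) = i + 1
    · obtain rfl : j = ⟨i + 1, h⟩ := Fin.ext h2
      exact H2
    · exact H j h1 h2

lemma forall_fin_iff_of_not_succ_lt {n : ℕ} (P : Fin n → Prop) (i : ℕ) (hi : i < n)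
    (h : ¬ i + 1 < n) :
    (∀ j, P j) ↔ AwayFrom i P ∧ P ⟨i, hi⟩ := by
  refine ⟨fun H => ⟨fun j _ _ => H j, H _⟩, fun ⟨H, H1⟩ j => ?_⟩
  by_cases h1 : (j : ℕ) = i
  · obtain rfl : j = ⟨i, hi⟩ := Fin.ext h1
    exact H1
  · exact H j h1 (by omega)

lemma sum_precBox_shift {n : ℕ} (F : (Fin n → ℤ) → ℝ) (y v : Fin n → ℤ) :
    ∑ x ∈ precBox y, F (x + v) = ∑ x ∈ (precBox y).map (addRightEmbedding v), F x := by
  simp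

lemma mem_precBox_map_shift {n : ℕ} {x y v : Fin n → ℤ} :
    x ∈ (precBox y).map (addRightEmbedding v) ↔ ∀ j, precLower y j ≤ x j - v j ∧ x j - v j ≤ y j := by
  have : x ∈ (precBox y).map (addRightEmbedding v) ↔ x - v ∈ precBox y := by
    simp only [Finset.mem_map, addRightEmbedding_apply]
    exact ⟨by rintro ⟨a, ha, rfl⟩; simpa using ha, fun h => ⟨_, h, by simp⟩⟩
  simp [this, mem_precBox]

/-- Away from the coordinates `i` and `i + 1`, moving `y` or `x` along `e_i` does not change the
box constraints. -/
lemma awayFrom_add_single_iff {n : ℕ} (x y : Fin n → ℤ) (i : Fin n) (c : ℤ) :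
    AwayFrom i (fun j => precLower y j + (if (j : ℕ) = i + 1 then c else 0) ≤ x j ∧
        x j ≤ y j + Pi.single (M := fun _ => ℤ) i c j) ↔
      AwayFrom i (fun j => precLower y j ≤ x j ∧ x j ≤ y j) := by
  refine AwayFrom.congr fun j ha hb => ?_
  have hj : j ≠ i := fun e => ha (congrArg _ e)
  simp [hb, Pi.single_eq_of_ne hj]

lemma awayFrom_sub_single_iff {n : ℕ} (x y : Fin n → ℤ) (i : Fin n) (c : ℤ) :
    AwayFrom i (fun j => precLower y j ≤ x j - Pi.single (M := fun _ => ℤ) i c j ∧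
        x j - Pi.single (M := fun _ => ℤ) i c j ≤ y j) ↔
      AwayFrom i (fun j => precLower y j ≤ x j ∧ x j ≤ y j) := by
  refine AwayFrom.congr fun j ha hb => ?_
  have hj : j ≠ i := fun e => ha (congrArg _ e)
  simp [Pi.single_eq_of_ne hj]

lemma awayFrom_ne_left_iff {n : ℕ} (i : ℕ) (P : Fin n → Prop) :
    AwayFrom i (fun j => (j : ℕ) ≠ i → P j) ↔ AwayFrom i P :=
  AwayFrom.congr fun j ha hb => by tauto

lemma awayFrom_ne_right_iff {n : ℕ} (i : ℕ) (P : Fin n → Prop) :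
    AwayFrom i (fun j => (j : ℕ) ≠ i + 1 → P j) ↔ AwayFrom i P :=
  AwayFrom.congr fun j ha hb => by tauto

lemma sum_precBox_add_single {n : ℕ} (F : (Fin n → ℤ) → ℝ) (hF : ∀ x, ¬ W0 x → F x = 0)
    {y : Fin n → ℤ} (hy : W0 y) (i : Fin n) :
    ∑ x ∈ precBox (y + Pi.single i 1), F x + ∑ x ∈ lowerFace y (i + 1), F x =
      ∑ x ∈ precBox y, F (x + Pi.single i 1) + ∑ x ∈ lowerFace y i, F x := by
  classical
  rw [sum_precBox_shift]
  refine sum_add_sum_eq_of_indicator F _ _ _ _ fun x hx => ?_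
  have hxW : W0 x := by_contra fun h => hx (hF x h)
  simp only [mem_precBox_map_shift, mem_precBox, mem_lowerFace]
  have hlo := hy.precLower_le i
  have e : (⟨i, i.2⟩ : Fin n) = i := rfl
  by_cases h : (i : ℕ) + 1 < n
  · have hne : (⟨i + 1, h⟩ : Fin n) ≠ i := by
      intro e; have := congrArg Fin.val e; simp at this
    have h1 := precLower_succ y i h
    have hle : i ≤ (⟨i + 1, h⟩ : Fin n) := Nat.le_succ _
    have h2 := hy.1 hle
    have h3 := hxW.1 hle
    simp only [forall_fin_iff_of_succ_lt _ i h, precLower_add_single, e, h1, Pi.add_apply,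
      Pi.single_eq_same, Pi.single_eq_of_ne hne, h, i.2, exists_true_left,
      awayFrom_add_single_iff, awayFrom_sub_single_iff]
    generalize AwayFrom (i : ℕ) (fun j => precLower y j ≤ x j ∧ x j ≤ y j) = R
    by_cases hR : R
    · simp only [hR, true_and, if_true]
      split_ifs <;> omega
    · simp [hR]
  · simp only [forall_fin_iff_of_not_succ_lt _ i i.2 h, precLower_add_single, e, Pi.add_apply,
      Pi.single_eq_same, h, i.2, exists_true_left, IsEmpty.exists_iff,
      awayFrom_add_single_iff, awayFrom_sub_single_iff]
    generalize AwayFrom (i : ℕ) (fun j => precLower y j ≤ x j ∧ x j ≤ y j) = R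
    by_cases hR : R
    · simp only [hR, true_and, and_false, if_false, left_eq_add, one_ne_zero, add_zero]
      split_ifs <;> omega
    · simp [hR]

lemma sum_precBox_sub_single {n : ℕ} (F : (Fin n → ℤ) → ℝ) (hF : ∀ x, ¬ W0 x → F x = 0)
    {y : Fin n → ℤ} (hy : W0 y) (i : Fin n) :
    ∑ x ∈ precBox (y - Pi.single i 1), F x + ∑ x ∈ outerFace y i, F x =
      ∑ x ∈ precBox y, F (x - Pi.single i 1) + ∑ x ∈ outerFace y (i + 1), F x := by
  classical
  have hneg : ∀ z : Fin n → ℤ, z - Pi.single i 1 = z + Pi.single i (-1) := fun z => by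
    rw [Pi.single_neg, sub_eq_add_neg]
  simp only [hneg]
  rw [sum_precBox_shift]
  refine sum_add_sum_eq_of_indicator F _ _ _ _ fun x hx => ?_
  have hxW : W0 x := by_contra fun h => hx (hF x h)
  simp only [mem_precBox_map_shift, mem_precBox, mem_outerFace hy]
  have hlo := hy.precLower_le i
  have e : (⟨i, i.2⟩ : Fin n) = i := rfl
  by_cases h : (i : ℕ) + 1 < n
  · have hne : (⟨i + 1, h⟩ : Fin n) ≠ i := by
      intro e; have := congrArg Fin.val e; simp at this
    have h1 := precLower_succ y i h
    have hle : i ≤ (⟨i + 1, h⟩ : Fin n) := Nat.le_succ _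
    have h2 := hy.1 hle
    have h3 := hxW.1 hle
    simp only [forall_fin_iff_of_succ_lt _ i h, precLower_add_single, e, h1, Pi.add_apply,
      Pi.single_eq_same, Pi.single_eq_of_ne hne, h, i.2, exists_true_left,
      awayFrom_add_single_iff, awayFrom_sub_single_iff,
      awayFrom_ne_left_iff, awayFrom_ne_right_iff]
    generalize AwayFrom (i : ℕ) (fun j => precLower y j ≤ x j ∧ x j ≤ y j) = R
    by_cases hR : R
    · simp only [hR, true_and, if_true]
      split_ifs <;> omega
    · simp [hR]
  · simp only [forall_fin_iff_of_not_succ_lt _ i i.2 h, precLower_add_single, e, Pi.add_apply,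
      Pi.single_eq_same, h, i.2, exists_true_left, IsEmpty.exists_iff,
      awayFrom_add_single_iff, awayFrom_sub_single_iff,
      awayFrom_ne_left_iff, awayFrom_ne_right_iff]
    generalize AwayFrom (i : ℕ) (fun j => precLower y j ≤ x j ∧ x j ≤ y j) = R
    by_cases hR : R
    · simp only [hR, true_and, if_false, left_eq_add, one_ne_zero, add_zero]
      split_ifs <;> omega
    · simp [hR]

/-- Summing a discrete harmonic-type function on `W₀` over the boxes `{x ≺ y}` gives again such
a function of `y`; the reflection term at the wall `x_1 = 0` is absorbed. -/
lemma sum_precBox_harmonic {m : ℕ} (F : (Fin (m + 1) → ℤ) → ℝ) (hF : ∀ x, ¬ W0 x → F x = 0)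
    (a c : ℝ)
    (hh : ∀ x, W0 x → ∑ i, (a⁻¹ * F (x + Pi.single i 1) + a * F (x - Pi.single i 1)) =
      (c + a⁻¹ * (if 0 < x 0 then 1 else 0) + a) * F x)
    {y : Fin (m + 1) → ℤ} (hy : W0 y) :
    ∑ i, (a⁻¹ * ∑ x ∈ precBox (y + Pi.single i 1), F x +
        a * ∑ x ∈ precBox (y - Pi.single i 1), F x) =
      (c + (a + a⁻¹)) * ∑ x ∈ precBox y, F x := by
  set B : ℕ → ℝ := fun j => ∑ x ∈ lowerFace y j, F x with hB
  set D : ℕ → ℝ := fun j => ∑ x ∈ outerFace y j, F x with hD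
  have hBn : B (m + 1) = 0 := by simp [hB, lowerFace]
  have hDn : D (m + 1) = 0 := by simp [hD, outerFace]
  have hD0 : D 0 = 0 := by
    refine Finset.sum_eq_zero fun x hx => hF x fun hW => ?_
    obtain ⟨h, h1, -⟩ := (mem_outerFace hy).1 hx
    rw [precLower_of_val_eq_zero _ rfl] at h1
    have := hW.2 ⟨0, h⟩
    omega
  have tel : ∀ E : ℕ → ℝ, ∑ i : Fin (m + 1), (E i - E (i + 1)) = E 0 - E (m + 1) := fun E => by
    rw [Fin.sum_univ_eq_sum_range (fun i => E i - E (i + 1)), Finset.sum_range_sub']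
  have hup : ∀ i : Fin (m + 1), ∑ x ∈ precBox (y + Pi.single i 1), F x =
      ∑ x ∈ precBox y, F (x + Pi.single i 1) + (B i - B (i + 1)) := fun i => by
    have := sum_precBox_add_single F hF hy i
    simp only [hB]; linarith
  have hdown : ∀ i : Fin (m + 1), ∑ x ∈ precBox (y - Pi.single i 1), F x =
      ∑ x ∈ precBox y, F (x - Pi.single i 1) - (D i - D (i + 1)) := fun i => by
    have := sum_precBox_sub_single F hF hy i
    simp only [hD]; linarith
  have hB0 : B 0 = ∑ x ∈ precBox y, (1 - if 0 < x 0 then 1 else 0) * F x := by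
    simp only [hB, lowerFace, Finset.sum_filter]
    refine Finset.sum_congr rfl fun x hx => ?_
    have := (W0.of_mem_precBox hx).2 0
    have e : (⟨0, Nat.succ_pos m⟩ : Fin (m + 1)) = 0 := rfl
    have hl : precLower y 0 = 0 := precLower_of_val_eq_zero y rfl
    simp only [Nat.succ_pos, exists_true_left, e, hl]
    by_cases h0 : x 0 = 0
    · simp [h0]
    · have : 0 < x 0 := by omega
      simp [h0, this]
  have hswap : ∑ i, (a⁻¹ * ∑ x ∈ precBox y, F (x + Pi.single i 1) +
      a * ∑ x ∈ precBox y, F (x - Pi.single i 1)) =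
      ∑ x ∈ precBox y, (c + a⁻¹ * (if 0 < x 0 then 1 else 0) + a) * F x := by
    simp only [Finset.mul_sum, ← Finset.sum_add_distrib]
    rw [Finset.sum_comm]
    exact Finset.sum_congr rfl fun x hx => hh x (W0.of_mem_precBox hx)
  calc _ = ∑ i : Fin (m + 1), ((a⁻¹ * ∑ x ∈ precBox y, F (x + Pi.single i 1) +
        a * ∑ x ∈ precBox y, F (x - Pi.single i 1)) +
        (a⁻¹ * (B i - B (i + 1)) - a * (D i - D (i + 1)))) := by
        refine Finset.sum_congr rfl fun i _ => ?_
        rw [hup, hdown]; ring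
    _ = ∑ x ∈ precBox y, (c + a⁻¹ * (if 0 < x 0 then 1 else 0) + a) * F x + a⁻¹ * B 0 := by
        rw [Finset.sum_add_distrib, hswap, Finset.sum_sub_distrib, ← Finset.mul_sum,
          ← Finset.mul_sum, tel, tel, hBn, hDn, hD0]
        ring
    _ = _ := by
        rw [hB0, Finset.mul_sum, Finset.mul_sum, ← Finset.sum_add_distrib]
        exact Finset.sum_congr rfl fun x _ => by ring

/-- Rates on `W₀` built from the neighbour values of `g` sum up to the sum over the `2n`
neighbours. -/
lemma finsum_W0_nearest_neighbour {n : ℕ} (d : ℝ) (g Q : (Fin n → ℤ) → ℝ) {x : Fin n → ℤ}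
    (hx : W0 x) (hg : ∀ z, ¬ W0 z → g z = 0) (hQx : Q x = d)
    (hQ : ∀ z, z ≠ x → (∃ i, z = x + Pi.single i 1 ∨ z = x - Pi.single i 1) → W0 z → Q z = g z)
    (hQ0 : ∀ z, z ≠ x → (¬ ∃ i, z = x + Pi.single i 1 ∨ z = x - Pi.single i 1) → Q z = 0) :
    ∑ᶠ z ∈ {z | W0 z}, Q z = d + ∑ i, (g (x + Pi.single i 1) + g (x - Pi.single i 1)) := by
  classical
  set P : Finset (Fin n → ℤ) := Finset.univ.image fun i => x + Pi.single i 1 with hP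
  set M : Finset (Fin n → ℤ) := Finset.univ.image fun i => x - Pi.single i 1 with hM
  have mP : ∀ {z}, z ∈ P → ∑ j, z j = ∑ j, x j + 1 := by
    intro z hz
    obtain ⟨i, -, rfl⟩ := Finset.mem_image.1 hz
    simp [Finset.sum_add_distrib]
  have mM : ∀ {z}, z ∈ M → ∑ j, z j = ∑ j, x j - 1 := by
    intro z hz
    obtain ⟨i, -, rfl⟩ := Finset.mem_image.1 hz
    simp [Finset.sum_sub_distrib]
  have hdisj : Disjoint P M := Finset.disjoint_left.2 fun z h1 h2 => by
    have := mP h1; have := mM h2; omega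
  have hxn : x ∉ P ∪ M := fun h => by
    rcases Finset.mem_union.1 h with h | h
    · have := mP h; omega
    · have := mM h; omega
  have hmem : ∀ z, z ∈ P ∪ M ↔ ∃ i, z = x + Pi.single i 1 ∨ z = x - Pi.single i 1 := fun z => by
    simp only [hP, hM, Finset.mem_union, Finset.mem_image, Finset.mem_univ, true_and, exists_or,
      eq_comm]
  have hinj : Function.Injective fun i : Fin n => (Pi.single i 1 : Fin n → ℤ) := by
    intro i j hij
    by_contra hne
    have := congrFun hij i
    simp [hne] at this
  rw [finsum_mem_def, finsum_eq_sum_of_support_subset (s := insert x (P ∪ M)),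
    Finset.sum_insert hxn, Set.indicator_of_mem (show x ∈ {z | W0 z} from hx), hQx]
  · congr 1
    have : ∀ z ∈ P ∪ M, Set.indicator {z | W0 z} Q z = g z := by
      intro z hz
      by_cases hW : W0 z
      · rw [Set.indicator_of_mem (show z ∈ {z | W0 z} from hW)]
        exact hQ z (fun e => hxn (e ▸ hz)) ((hmem z).1 hz) hW
      · rw [Set.indicator_of_notMem (show z ∉ {z | W0 z} from hW), hg z hW]
    rw [Finset.sum_congr rfl this, Finset.sum_union hdisj, hP, hM,
      Finset.sum_image fun i _ j _ h => hinj (add_left_cancel h),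
      Finset.sum_image fun i _ j _ h => hinj (sub_right_injective h),
      ← Finset.sum_add_distrib]
  · intro z hz
    by_contra hcon
    simp only [Finset.coe_insert, Set.mem_insert_iff, Finset.mem_coe, not_or] at hcon
    refine hz ?_
    simp [Set.indicator_apply, hQ0 z hcon.1 (fun h => hcon.2 ((hmem z).2 h))]

/-- The symplectic patterns with `n` rows and bottom row `z`. -/
def sympPatterns (n : ℕ) {k : ℕ} (z : Fin k → ℤ) : Set (ℕ → ℕ → ℤ) :=
  {p | IsSymp n p ∧ ∀ i : Fin k, p n i = z i}

lemma wSymp_pos (n : ℕ) {q : ℕ → ℝ} (hq : ∀ i, 0 < q i) (p : ℕ → ℕ → ℤ) : 0 < wSymp n q p :=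
  Finset.prod_pos fun _ _ => zpow_pos (hq _) _

lemma finsum_mem_nonneg_of_pos {α : Type*} {f : α → ℝ} (hf : ∀ a, 0 < f a) (s : Set α) :
    0 ≤ ∑ᶠ a ∈ s, f a :=
  finsum_nonneg fun a => finsum_nonneg fun _ => (hf a).le

lemma finite_of_finsum_mem_ne_zero {α : Type*} {f : α → ℝ} (hf : ∀ a, 0 < f a) {s : Set α}
    (h : ∑ᶠ a ∈ s, f a ≠ 0) : s.Finite := by
  by_contra hs
  refine h (finsum_mem_eq_zero_of_infinite ?_)
  have : Function.support f = Set.univ := Set.eq_univ_of_forall fun a => (hf a).ne'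
  rwa [this, Set.inter_univ]

/-- Replace row `r` of the pattern `p` by `y`, padded with zeros. -/
def setRow {k : ℕ} (r : ℕ) (y : Fin k → ℤ) (p : ℕ → ℕ → ℤ) : ℕ → ℕ → ℤ :=
  Function.update p r fun i => if h : i < k then y ⟨i, h⟩ else 0

lemma setRow_self {k : ℕ} (r : ℕ) (y : Fin k → ℤ) (p : ℕ → ℕ → ℤ) (i : Fin k) :
    setRow r y p r i = y i := by
  simp [setRow]

lemma setRow_of_ne {k : ℕ} {r s : ℕ} (h : s ≠ r) (y : Fin k → ℤ) (p : ℕ → ℕ → ℤ) :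
    setRow r y p s = p s := by
  simp [setRow, h]

lemma rowSumS_setRow_of_ne {k : ℕ} {r s : ℕ} (h : s ≠ r) (y : Fin k → ℤ) (p : ℕ → ℕ → ℤ) :
    rowSumS (setRow r y p) s = rowSumS p s := by
  simp [rowSumS, setRow_of_ne h]

lemma rowSumS_eq_vsum {k r : ℕ} (hk : (r + 1) / 2 = k) {p : ℕ → ℕ → ℤ} {z : Fin k → ℤ}
    (h : ∀ i : Fin k, p r i = z i) : rowSumS p r = vsum z := by
  rw [rowSumS, hk, vsum, ← Fin.sum_univ_eq_sum_range]
  exact Finset.sum_congr rfl fun i _ => h i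

lemma wSymp_setRow {m : ℕ} {q : ℕ → ℝ} {x y : Fin (m + 1) → ℤ}
    {p : ℕ → ℕ → ℤ} (hp : ∀ i : Fin (m + 1), p (2 * m + 1) i = x i) :
    wSymp (2 * m + 2) q (setRow (2 * m + 2) y p) =
      q m ^ (vsum x - vsum y) * wSymp (2 * m + 1) q p := by
  rw [wSymp, Finset.prod_Icc_succ_top (by omega), mul_comm]
  congr 1
  · rw [rowSumS_eq_vsum (by omega) (setRow_self (2 * m + 2) y p), Nat.add_sub_cancel,
      rowSumS_setRow_of_ne (by omega), rowSumS_eq_vsum (by omega) hp]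
    have e1 : (2 * m + 1 + 1 + 1) / 2 - 1 = m := by omega
    have e2 : (2 * m + 1 + 1) % 2 ≠ 1 := by omega
    rw [e1, if_neg e2]
    congr 1
    ring
  · refine Finset.prod_congr rfl fun r hr => ?_
    rw [Finset.mem_Icc] at hr
    rw [rowSumS_setRow_of_ne (by omega), rowSumS_setRow_of_ne (by omega)]

lemma bijOn_setRow {m : ℕ} {x y : Fin (m + 1) → ℤ} (hx : x ∈ precBox y) :
    Set.BijOn (setRow (2 * m + 2) y) (sympPatterns (2 * m + 1) x)
      {p ∈ sympPatterns (2 * m + 2) y | ∀ i : Fin (m + 1), p (2 * m + 1) i = x i} := by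
  have hx0 := W0.of_mem_precBox hx
  rw [mem_precBox] at hx
  refine ⟨?_, ?_, ?_⟩
  · rintro p ⟨⟨h1, h2, h3, h4⟩, hpx⟩
    have hne : ∀ {r}, r ≤ 2 * m + 1 → setRow (2 * m + 2) y p r = p r := fun h =>
      setRow_of_ne (by omega) y p
    have hy : ∀ j (hj : j < m + 1), setRow (2 * m + 2) y p (2 * m + 2) j = y ⟨j, hj⟩ :=
      fun j hj => setRow_self (2 * m + 2) y p ⟨j, hj⟩
    refine ⟨⟨⟨?_, ?_, ?_, ?_⟩, setRow_self _ _ _⟩, fun i => by rw [hne le_rfl, hpx]⟩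
    · intro r i hr hr' hi
      rcases hr'.lt_or_eq with h | rfl
      · rw [hne (by omega)]
        exact h1 r i hr (by omega) hi
      · rw [hy i (by omega)]
        exact (hx0.2 _).trans (hx _).2
    · intro k hk hk'
      rcases hk'.lt_or_eq with h | h
      · rw [hne (by omega), hne (by omega)]
        exact h2 k hk (by omega)
      · obtain rfl : k = m + 1 := by omega
        rw [show 2 * (m + 1) - 1 = 2 * m + 1 by omega, show 2 * (m + 1) = 2 * m + 2 by omega,
          hne le_rfl]
        refine ⟨fun j hj => ?_, fun j hj => ?_⟩
        · rw [hy j hj, ← (hpx ⟨j, hj⟩).symm]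
          exact (hx _).2
        · rw [hy j (by omega), ← (hpx ⟨j + 1, hj⟩).symm]
          have := (hx ⟨j + 1, hj⟩).1
          rwa [precLower_succ] at this
    · intro k hk hk'
      rw [hne (by omega), hne (by omega)]
      exact h3 k hk (by omega)
    · intro r i hr
      by_cases h : r = 2 * m + 2
      · subst h
        rw [setRow, Function.update_self, dif_neg (by omega)]
      · rw [setRow_of_ne h]
        exact h4 r i (by omega)
  · rintro p ⟨⟨-, -, -, h4⟩, -⟩ p' ⟨⟨-, -, -, h4'⟩, -⟩ hpp
    funext r
    by_cases h : r = 2 * m + 2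
    · funext i
      rw [h4 r i (by omega), h4' r i (by omega)]
    · have := congrFun hpp r
      rwa [setRow_of_ne h, setRow_of_ne h] at this
  · rintro p ⟨⟨⟨h1, h2, h3, h4⟩, hpy⟩, hpx⟩
    refine ⟨Function.update p (2 * m + 2) 0, ⟨⟨?_, ?_, ?_, ?_⟩, ?_⟩, ?_⟩
    · intro r i hr hr' hi
      rw [Function.update_of_ne (by omega)]
      exact h1 r i hr (by omega) hi
    · intro k hk hk'
      rw [Function.update_of_ne (by omega), Function.update_of_ne (by omega)]
      exact h2 k hk (by omega)
    · intro k hk hk'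
      rw [Function.update_of_ne (by omega), Function.update_of_ne (by omega)]
      exact h3 k hk (by omega)
    · intro r i hr
      by_cases h : r = 2 * m + 2
      · simp [h]
      · rw [Function.update_of_ne h]
        exact h4 r i (by omega)
    · intro i
      rw [Function.update_of_ne (by omega)]
      exact hpx i
    · rw [setRow, Function.update_idem]
      refine Function.update_eq_self_iff.2 (funext fun i => ?_)
      split_ifs with h
      · exact (hpy ⟨i, h⟩).symm
      · exact (h4 _ _ (by omega)).symm

lemma sympPatterns_even_eq_biUnion {m : ℕ} (y : Fin (m + 1) → ℤ) :
    sympPatterns (2 * m + 2) y = ⋃ x ∈ (precBox y : Set (Fin (m + 1) → ℤ)),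
      {p ∈ sympPatterns (2 * m + 2) y | ∀ i : Fin (m + 1), p (2 * m + 1) i = x i} := by
  ext p
  simp only [Set.mem_iUnion, Set.mem_ofPred_eq, exists_prop]
  refine ⟨fun hp => ⟨fun i => p (2 * m + 1) i, ?_, hp, fun _ => rfl⟩, fun ⟨_, _, hp, _⟩ => hp⟩
  obtain ⟨⟨h1, h2, -, -⟩, hpy⟩ := hp
  obtain ⟨h2, h2'⟩ := h2 (m + 1) (by omega) (by omega)
  rw [Finset.mem_coe, mem_precBox]
  refine fun j => ⟨?_, ?_⟩
  · by_cases h0 : (j : ℕ) = 0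
    · rw [precLower_of_val_eq_zero y h0]
      exact h1 _ _ (by omega) (by omega) (by omega)
    · obtain ⟨_ | j, hj⟩ := j
      · exact absurd rfl h0
      · rw [precLower_succ, ← hpy]
        exact h2' j hj
  · rw [← hpy]
    exact h2 j j.2

/-- Branching of the even symplectic Schur function along its last row. -/
lemma SpEven_eq_sum {m : ℕ} {q : ℕ → ℝ} (y : Fin (m + 1) → ℤ)
    (hfin : ∀ x ∈ precBox y, (sympPatterns (2 * m + 1) x).Finite) :
    SpEven (m + 1) q y =
      ∑ x ∈ precBox y, q m ^ (vsum x - vsum y) * SpOdd (m + 1) q x := by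
  have e : SpEven (m + 1) q y = ∑ᶠ p ∈ sympPatterns (2 * m + 2) y, wSymp (2 * m + 2) q p := rfl
  rw [e, sympPatterns_even_eq_biUnion, finsum_mem_biUnion, finsum_mem_coe_finset]
  · refine Finset.sum_congr rfl fun x hx => ?_
    have e' : SpOdd (m + 1) q x = ∑ᶠ p ∈ sympPatterns (2 * m + 1) x, wSymp (2 * m + 1) q p := rfl
    rw [e', mul_finsum_mem]
    exact (finsum_mem_eq_of_bijOn _ (bijOn_setRow hx) fun p hp => (wSymp_setRow hp.2).symm).symm
  · intro x _ x' _ hne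
    refine Set.disjoint_left.2 fun p hp hp' => hne ?_
    funext i
    rw [← hp.2, ← hp'.2]
  · exact Finset.finite_toSet _
  · intro x hx
    rw [← (bijOn_setRow hx).image_eq]
    exact (hfin x hx).image _

lemma vsum_add_single {n : ℕ} (x : Fin n → ℤ) (i : Fin n) (c : ℤ) :
    vsum (x + Pi.single i c) = vsum x + c := by
  simp [vsum, Finset.sum_add_distrib]

lemma vsum_sub_single {n : ℕ} (x : Fin n → ℤ) (i : Fin n) (c : ℤ) :
    vsum (x - Pi.single i c) = vsum x - c := by
  simp [vsum, Finset.sum_sub_distrib]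

open Classical in
lemma finsum_Qodd (m : ℕ) (q : ℕ → ℝ) {x : Fin (m + 1) → ℤ} (hx : W0 x) :
    ∑ᶠ z ∈ {z : Fin (m + 1) → ℤ | W0 z}, Qodd m q x z =
      -((∑ i ∈ Finset.range m, (q i + (q i)⁻¹)) +
        (q m)⁻¹ * (if 0 < x 0 then 1 else 0) + q m) +
      ∑ i, ((if W0 (x + Pi.single i 1) then SpOdd (m + 1) q (x + Pi.single i 1) else 0) /
          SpOdd (m + 1) q x +
        (if W0 (x - Pi.single i 1) then SpOdd (m + 1) q (x - Pi.single i 1) else 0) /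
          SpOdd (m + 1) q x) := by
  refine finsum_W0_nearest_neighbour _
    (fun z => (if W0 z then SpOdd (m + 1) q z else 0) / SpOdd (m + 1) q x) _ hx ?_ ?_ ?_ ?_
  · intro z hz
    simp [hz]
  · simp [Qodd]
  · intro z hne hz hW
    rw [Qodd, if_neg hne, if_pos ⟨hz, hW⟩, if_pos hW]
  · intro z hne hz
    rw [Qodd, if_neg hne, if_neg fun h => hz h.1]

open Classical in
lemma finsum_Qeven (m : ℕ) (q : ℕ → ℝ) {y : Fin (m + 1) → ℤ} (hy : W0 y) :
    ∑ᶠ z ∈ {z : Fin (m + 1) → ℤ | W0 z}, Qeven m q y z =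
      -(∑ i ∈ Finset.range (m + 1), (q i + (q i)⁻¹)) +
      ∑ i, ((if W0 (y + Pi.single i 1) then SpEven (m + 1) q (y + Pi.single i 1) else 0) /
          SpEven (m + 1) q y +
        (if W0 (y - Pi.single i 1) then SpEven (m + 1) q (y - Pi.single i 1) else 0) /
          SpEven (m + 1) q y) := by
  refine finsum_W0_nearest_neighbour _
    (fun z => (if W0 z then SpEven (m + 1) q z else 0) / SpEven (m + 1) q y) _ hy ?_ ?_ ?_ ?_
  · intro z hz
    simp [hz]
  · simp [Qeven]
  · intro z hne hz hW
    rw [Qeven, if_neg hne, if_pos ⟨hz, hW⟩, if_pos hW]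
  · intro z hne hz
    rw [Qeven, if_neg hne, if_neg fun h => hz h.1]

/-- A conservative odd row forces the odd symplectic Schur function not to vanish, as the diagonal
of `Qodd` is negative. -/
lemma SpOdd_ne_zero_of_conservative {m : ℕ} {q : ℕ → ℝ} (hq : ∀ i, 0 < q i)
    {x : Fin (m + 1) → ℤ} (hx : W0 x)
    (h : ∑ᶠ x' ∈ {x' : Fin (m + 1) → ℤ | W0 x'}, Qodd m q x x' = 0) :
    SpOdd (m + 1) q x ≠ 0 := by
  intro h0
  rw [finsum_Qodd m q hx, h0] at h
  simp only [div_zero, add_zero, Finset.sum_const_zero] at h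
  have h1 : 0 ≤ ∑ i ∈ Finset.range m, (q i + (q i)⁻¹) :=
    Finset.sum_nonneg fun i _ => add_nonneg (hq i).le (inv_nonneg.2 (hq i).le)
  have h2 : 0 ≤ (q m)⁻¹ * (if 0 < x 0 then (1 : ℝ) else 0) :=
    mul_nonneg (inv_nonneg.2 (hq m).le) (by split_ifs <;> norm_num)
  linarith [hq m]

/-- Conservativity propagates from odd to even rows (here `n = m+1`): if all rows of
`Q_{2n−1}` sum to zero over `W₀^n`, then so do all rows of `Q_{2n}`. -/
theorem wall_conservative_odd_to_even (m : ℕ) (q : ℕ → ℝ)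
    (hq : ∀ i, 0 < q i ∧ q i < 1)
    (h : ∀ x : Fin (m + 1) → ℤ, W0 x →
      ∑ᶠ x' ∈ {x' : Fin (m + 1) → ℤ | W0 x'}, Qodd m q x x' = 0) :
    ∀ y : Fin (m + 1) → ℤ, W0 y →
      ∑ᶠ y' ∈ {y' : Fin (m + 1) → ℤ | W0 y'}, Qeven m q y y' = 0 := by
  classical
  intro y hy
  have hpos : ∀ i, 0 < q i := fun i => (hq i).1
  have hqm : q m ≠ 0 := (hpos m).ne'
  have hS0 : ∀ x : Fin (m + 1) → ℤ, W0 x → SpOdd (m + 1) q x ≠ 0 := fun x hx =>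
    SpOdd_ne_zero_of_conservative hpos hx (h x hx)
  have hS : ∀ x : Fin (m + 1) → ℤ, W0 x → 0 < SpOdd (m + 1) q x := fun x hx =>
    lt_of_le_of_ne (finsum_mem_nonneg_of_pos (wSymp_pos _ hpos) _) (hS0 x hx).symm
  set F : (Fin (m + 1) → ℤ) → ℝ :=
    fun x => q m ^ vsum x * (if W0 x then SpOdd (m + 1) q x else 0) with hFdef
  have hE : ∀ z : Fin (m + 1) → ℤ,
      SpEven (m + 1) q z = (q m ^ vsum z)⁻¹ * ∑ x ∈ precBox z, F x := fun z => by
    rw [SpEven_eq_sum z fun x hx => finite_of_finsum_mem_ne_zero (wSymp_pos _ hpos)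
      (hS0 x (W0.of_mem_precBox hx)), Finset.mul_sum]
    refine Finset.sum_congr rfl fun x hx => ?_
    rw [hFdef, zpow_sub₀ hqm]
    simp only [W0.of_mem_precBox hx, if_true]
    ring
  have hE' : ∀ z : Fin (m + 1) → ℤ, (if W0 z then SpEven (m + 1) q z else 0) =
      (q m ^ vsum z)⁻¹ * ∑ x ∈ precBox z, F x := fun z => by
    split_ifs with hz
    · exact hE z
    · simp [precBox_eq_empty hz]
  have hharm := sum_precBox_harmonic F (fun x hx => by simp [hFdef, hx]) (q m)
    (∑ i ∈ Finset.range m, (q i + (q i)⁻¹)) (fun x hx => by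
      have hx' := h x hx
      rw [finsum_Qodd m q hx] at hx'
      simp only [← add_div, ← Finset.sum_div] at hx'
      rw [neg_add_eq_zero, eq_div_iff (hS0 x hx)] at hx'
      simp only [hFdef, vsum_add_single, vsum_sub_single, zpow_add₀ hqm, zpow_sub₀ hqm, zpow_one,
        hx, if_true]
      rw [mul_left_comm, hx', Finset.mul_sum]
      refine Finset.sum_congr rfl fun i _ => ?_
      field_simp) hy
  have hT : 0 < ∑ x ∈ precBox y, F x := by
    refine Finset.sum_pos (fun x hx => ?_) ⟨y, hy.self_mem_precBox⟩
    have hxW := W0.of_mem_precBox hx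
    simp only [hFdef, hxW, if_true]
    exact mul_pos (zpow_pos (hpos m) _) (hS x hxW)
  have hEy : SpEven (m + 1) q y ≠ 0 := by
    rw [hE]
    exact (mul_pos (inv_pos.2 (zpow_pos (hpos m) _)) hT).ne'
  rw [finsum_Qeven m q hy]
  simp only [← add_div, ← Finset.sum_div]
  rw [neg_add_eq_zero, eq_div_iff hEy, Finset.sum_range_succ, hE y, mul_left_comm, ← hharm,
    Finset.mul_sum]
  refine Finset.sum_congr rfl fun i _ => ?_
  rw [hE', hE', vsum_add_single, vsum_sub_single, zpow_add₀ hqm, zpow_sub₀ hqm, zpow_one]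
  field_simp

end
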